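/- Suppose the source pmf satisfies the full-support condition supp(S,U,V) = supp(S) × supp(U,V). Then for every k ∈ ℕ and every D ≥ 0, the rate region ℛ‡_k(D) is a subset of ℛ*_{k²}(D). -/

import Mathlib

open Finset

namespace CRR

open scoped Classical

variable {Ω α β γ : Type*}

/-- A probability mass function on a finite type, given as a function. -/
def IsPMF [Fintype Ω] (p : Ω → ℝ) : Prop := (∀ ω, 0 ≤ p ω) ∧ ∑ ω, p ω = 1

/-- Pushforward pmf: the pmf of the random variable `X` when the outcome is drawn from `p`. -/
noncomputable def push [Fintype Ω] (p : Ω → ℝ) (X : Ω → α) (a : α) : ℝ :=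
  ∑ ω, if X ω = a then p ω else 0

/-- Shannon entropy (base 2) of a pmf, with the convention 0·log 0 = 0. -/
noncomputable def ent [Fintype α] (q : α → ℝ) : ℝ := -∑ a, q a * Real.logb 2 (q a)

/-- Entropy of a random variable `X` under `p`. -/
noncomputable def entRV [Fintype Ω] [Fintype α] (p : Ω → ℝ) (X : Ω → α) : ℝ := ent (push p X)

/-- Conditional entropy H(X|Y) under `p`. -/
noncomputable def condEntRV [Fintype Ω] [Fintype α] [Fintype β] (p : Ω → ℝ)
    (X : Ω → α) (Y : Ω → β) : ℝ :=
  entRV p (fun ω => (X ω, Y ω)) - entRV p Y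

/-- Conditional mutual information I(X;Y|Z) under `p`. -/
noncomputable def condMI [Fintype Ω] [Fintype α] [Fintype β] [Fintype γ] (p : Ω → ℝ)
    (X : Ω → α) (Y : Ω → β) (Z : Ω → γ) : ℝ :=
  entRV p (fun ω => (X ω, Z ω)) + entRV p (fun ω => (Y ω, Z ω)) -
    entRV p (fun ω => (X ω, Y ω, Z ω)) - entRV p Z

/-- Markov chain X – Y – Z : X and Z are conditionally independent given Y, under `p`. -/
def MarkovChain [Fintype Ω] (p : Ω → ℝ) (X : Ω → α) (Y : Ω → β) (Z : Ω → γ) : Prop :=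
  ∀ x y z, push p (fun ω => (X ω, Y ω, Z ω)) (x, y, z) * push p Y y =
    push p (fun ω => (X ω, Y ω)) (x, y) * push p (fun ω => (Z ω, Y ω)) (z, y)

/-- One step between right nodes of the bipartite graph G^{X,Y}: they share a left neighbour. -/
def GKStep (p : α × β → ℝ) (y₁ y₂ : β) : Prop := ∃ x, 0 < p (x, y₁) ∧ 0 < p (x, y₂)

/-- y₁ ⇌ y₂ : y₁ and y₂ lie in the same connected component of G^{X,Y}. -/
def GKConn (p : α × β → ℝ) : β → β → Prop := Relation.ReflTransGen (GKStep p)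

/-- `g` is a Gács–Körner mapping for the joint pmf `p`. -/
def IsGKMap (p : α × β → ℝ) (g : β → β) : Prop := ∀ y₁ y₂, (g y₁ = g y₂ ↔ GKConn p y₁ y₂)

/-- Expectation of `f` under pmf `p`. -/
noncomputable def expVal [Fintype Ω] (p : Ω → ℝ) (f : Ω → ℝ) : ℝ := ∑ ω, p ω * f ω

section RateRegions

variable {S U V W : Type*} [Fintype S] [Fintype U] [Fintype V] [Fintype W]

/-- The class 𝒫*_{D,k}: joint pmfs q on (Fin k) × S × U × V (auxiliary alphabet of size k)
with the required marginal, Markov chain A – S – (U,V), and a reconstruction function of the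
Gács–Körner common randomness GK^{AU,AV} meeting distortion D. -/
def PStar (p : S × U × V → ℝ) (d : S → W → ℝ) (D : ℝ) (k : ℕ)
    (q : Fin k × S × U × V → ℝ) : Prop :=
  IsPMF q ∧ (∀ y, push q (fun x => x.2) y = p y) ∧
    MarkovChain q (fun x => x.1) (fun x => x.2.1) (fun x => x.2.2) ∧
    ∃ (g : Fin k × V → Fin k × V) (f : Fin k × V → W),
      IsGKMap (push q (fun x => ((x.1, x.2.2.1), (x.1, x.2.2.2)))) g ∧
      expVal q (fun x => d x.2.1 (f (g (x.1, x.2.2.2)))) ≤ D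

/-- The rate region ℛ*_k(D). -/
def RStar (p : S × U × V → ℝ) (d : S → W → ℝ) (D : ℝ) (k : ℕ) : Set (ℝ × ℝ) :=
  {r : ℝ × ℝ | 0 ≤ r.1 ∧ 0 ≤ r.2 ∧ ∃ q : Fin k × S × U × V → ℝ, PStar p d D k q ∧
    condMI q (fun x => x.2.1) (fun x => x.1) (fun x => x.2.2.1) ≤ r.1 ∧
    condMI q (fun x => x.2.1) (fun x => x.1) (fun x => x.2.2.2) ≤ r.2 + r.1}

/-- The class 𝒫‡_{D,k}: joint pmfs q on (Fin k × Fin k × Fin k) × S × U × V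
(coordinates (A,B,C,S,U,V)) with marginal p, Markov chain (A,B,C) – S – (U,V) and a
reconstruction function of GK^{ABU,ACV} meeting distortion D. -/
def PDdag (p : S × U × V → ℝ) (d : S → W → ℝ) (D : ℝ) (k : ℕ)
    (q : (Fin k × Fin k × Fin k) × S × U × V → ℝ) : Prop :=
  IsPMF q ∧ (∀ y, push q (fun x => x.2) y = p y) ∧
    MarkovChain q (fun x => x.1) (fun x => x.2.1) (fun x => x.2.2) ∧
    ∃ (g : Fin k × Fin k × V → Fin k × Fin k × V) (f : Fin k × Fin k × V → W),
      IsGKMap (push q (fun x => ((x.1.1, x.1.2.1, x.2.2.1), (x.1.1, x.1.2.2, x.2.2.2)))) g ∧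
      expVal q (fun x => d x.2.1 (f (g (x.1.1, x.1.2.2, x.2.2.2)))) ≤ D

/-- The rate region ℛ‡_k(D). -/
def RDdag (p : S × U × V → ℝ) (d : S → W → ℝ) (D : ℝ) (k : ℕ) : Set (ℝ × ℝ) :=
  {r : ℝ × ℝ | 0 ≤ r.1 ∧ 0 ≤ r.2 ∧
    ∃ q : (Fin k × Fin k × Fin k) × S × U × V → ℝ, PDdag p d D k q ∧
    condMI q (fun x => x.2.1) (fun x => (x.1.1, x.1.2.1)) (fun x => x.2.2.1) ≤ r.1 ∧
    condMI q (fun x => x.2.1) (fun x => x.1.2.1) (fun x => (x.1.1, x.1.2.2, x.2.2)) +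
      condMI q (fun x => x.2.1) (fun x => (x.1.1, x.1.2.2)) (fun x => x.2.2.2) ≤ r.2 + r.1}

/-- The class 𝒫†_{D,k}: members of 𝒫‡_{D,k} with additionally B – (A,S) – C. -/
def PDag (p : S × U × V → ℝ) (d : S → W → ℝ) (D : ℝ) (k : ℕ)
    (q : (Fin k × Fin k × Fin k) × S × U × V → ℝ) : Prop :=
  PDdag p d D k q ∧
    MarkovChain q (fun x => x.1.2.1) (fun x => (x.1.1, x.2.1)) (fun x => x.1.2.2)

/-- The rate region ℛ†_k(D). -/
def RDag (p : S × U × V → ℝ) (d : S → W → ℝ) (D : ℝ) (k : ℕ) : Set (ℝ × ℝ) :=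
  {r : ℝ × ℝ | 0 ≤ r.1 ∧ 0 ≤ r.2 ∧
    ∃ q : (Fin k × Fin k × Fin k) × S × U × V → ℝ, PDag p d D k q ∧
    condMI q (fun x => x.2.1) (fun x => (x.1.1, x.1.2.1)) (fun x => x.2.2.1) ≤ r.1 ∧
    max (condMI q (fun x => x.2.1) (fun x => x.1.1) (fun x => x.2.2.1))
        (condMI q (fun x => x.2.1) (fun x => x.1.1) (fun x => x.2.2.2)) +
      condMI q (fun x => x.2.1) (fun x => x.1.2.1) (fun x => (x.1.1, x.2.2.1)) +
      condMI q (fun x => x.2.1) (fun x => x.1.2.2) (fun x => (x.1.1, x.2.2.2)) ≤ r.2 + r.1}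

end RateRegions

section Pushforward

variable [Fintype Ω] {p : Ω → ℝ}

lemma push_nonneg (hp : ∀ ω, 0 ≤ p ω) (X : Ω → α) (a : α) : 0 ≤ push p X a :=
  Finset.sum_nonneg fun ω _ => by split_ifs <;> simp [hp]

lemma push_pos_iff (hp : ∀ ω, 0 ≤ p ω) {X : Ω → α} {a : α} :
    0 < push p X a ↔ ∃ ω, 0 < p ω ∧ X ω = a := by
  unfold push
  rw [Finset.sum_pos_iff_of_nonneg (fun ω _ => by split_ifs <;> simp [hp])]
  refine exists_congr fun ω => ?_
  by_cases h : X ω = a <;> simp [h]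

lemma push_apply_pos (hp : ∀ ω, 0 ≤ p ω) (X : Ω → α) {ω : Ω} (hω : 0 < p ω) :
    0 < push p X (X ω) :=
  (push_pos_iff hp).2 ⟨ω, hω, rfl⟩

lemma sum_push_mul [Fintype α] (p : Ω → ℝ) (X : Ω → α) (F : α → ℝ) :
    ∑ a, push p X a * F a = ∑ ω, p ω * F (X ω) := by
  simp only [push, Finset.sum_mul]
  rw [Finset.sum_comm]
  refine Finset.sum_congr rfl fun ω _ => ?_
  simp [ite_mul]

lemma sum_push [Fintype α] (p : Ω → ℝ) (X : Ω → α) : ∑ a, push p X a = ∑ ω, p ω := by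
  simpa using sum_push_mul p X fun _ => 1

lemma push_push [Fintype α] (p : Ω → ℝ) (X : Ω → α) (Y : α → β) :
    push (push p X) Y = push p fun ω => Y (X ω) := by
  funext b
  simpa [push, mul_ite] using sum_push_mul p X fun a => if Y a = b then (1 : ℝ) else 0

lemma sum_push_pair [Fintype α] (p : Ω → ℝ) (X : Ω → α) (Z : Ω → γ) (z : γ) :
    ∑ x, push p (fun ω => (X ω, Z ω)) (x, z) = push p Z z := by
  simp only [push]
  rw [Finset.sum_comm]
  refine Finset.sum_congr rfl fun ω _ => ?_
  by_cases h : Z ω = z <;> simp [h]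

lemma push_comp_pair [Fintype α] (p : Ω → ℝ) (h : α → β) (X : Ω → α) (Z : Ω → γ)
    (b : β) (z : γ) :
    push p (fun ω => (h (X ω), Z ω)) (b, z) =
      ∑ x, if h x = b then push p (fun ω => (X ω, Z ω)) (x, z) else 0 := by
  have hite : ∀ x, (if h x = b then push p (fun ω => (X ω, Z ω)) (x, z) else 0) =
      ∑ ω, if h x = b then (if (X ω, Z ω) = (x, z) then p ω else 0) else 0 := fun x => by
    split_ifs <;> simp [push]
  simp only [hite]
  rw [Finset.sum_comm, push]
  refine Finset.sum_congr rfl fun ω _ => ?_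
  by_cases hz : Z ω = z
  · by_cases hb : h (X ω) = b
    · rw [Finset.sum_eq_single (X ω)] <;> simp +contextual [hz, hb, eq_comm]
    · refine (by simp [hb] : _ = (0 : ℝ)).trans (Finset.sum_eq_zero fun x _ => ?_).symm
      rw [ite_eq_right_iff, ite_eq_right_iff]
      rintro rfl hx
      exact absurd (congrArg h (Prod.ext_iff.1 hx).1) hb
  · simp [hz]

lemma MarkovChain.comp_left {δ : Type*} [Fintype α] {X : Ω → α} {Y : Ω → β} {Z : Ω → γ}
    (hM : MarkovChain p X Y Z) (h : α → δ) : MarkovChain p (fun ω => h (X ω)) Y Z := by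
  intro x y z
  rw [push_comp_pair p h X (fun ω => (Y ω, Z ω)), push_comp_pair p h X Y, Finset.sum_mul,
    Finset.sum_mul]
  refine Finset.sum_congr rfl fun a _ => ?_
  split_ifs
  · exact hM a y z
  · simp

lemma MarkovChain.push_iff [Fintype α] {δ : Type*} {T : Ω → α} {X : α → β} {Y : α → γ}
    {Z : α → δ} :
    MarkovChain (push p T) X Y Z ↔
      MarkovChain p (fun ω => X (T ω)) (fun ω => Y (T ω)) fun ω => Z (T ω) := by
  simp only [MarkovChain, push_push]

end Pushforward

section Entropy

variable [Fintype Ω] [Fintype α] [Fintype β] [Fintype γ] {p : Ω → ℝ}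

lemma entRV_eq_sum (p : Ω → ℝ) (X : Ω → α) :
    entRV p X = -∑ ω, p ω * Real.logb 2 (push p X (X ω)) := by
  rw [entRV, ent, sum_push_mul p X fun a => Real.logb 2 (push p X a)]

/-- Entropy depends only on the partition of the support induced by the random variable. -/
lemma entRV_congr {X : Ω → α} {Y : Ω → β}
    (h : ∀ ω ω', p ω ≠ 0 → p ω' ≠ 0 → (X ω = X ω' ↔ Y ω = Y ω')) :
    entRV p X = entRV p Y := by
  rw [entRV_eq_sum, entRV_eq_sum]
  congr 1
  refine Finset.sum_congr rfl fun ω _ => ?_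
  by_cases hω : p ω = 0
  · simp [hω]
  · congr 2
    refine Finset.sum_congr rfl fun ω' _ => ?_
    by_cases hω' : p ω' = 0
    · simp [hω']
    · simp [h ω' ω hω' hω]

lemma sum_mul_div_push_le (hp : IsPMF p) (X : Ω → α) (Y : Ω → β) (Z : Ω → γ) :
    ∑ ω, p ω * (push p (fun ω => (X ω, Z ω)) (X ω, Z ω) *
      push p (fun ω => (Y ω, Z ω)) (Y ω, Z ω) /
        (push p (fun ω => (X ω, Y ω, Z ω)) (X ω, Y ω, Z ω) * push p Z (Z ω))) ≤ 1 := by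
  have hn := hp.1
  rw [← sum_push_mul p (fun ω => (X ω, Y ω, Z ω)) fun t =>
    push p (fun ω => (X ω, Z ω)) (t.1, t.2.2) * push p (fun ω => (Y ω, Z ω)) (t.2.1, t.2.2) /
      (push p (fun ω => (X ω, Y ω, Z ω)) t * push p Z t.2.2)]
  calc
    _ ≤ ∑ t : α × β × γ, push p (fun ω => (X ω, Z ω)) (t.1, t.2.2) *
          push p (fun ω => (Y ω, Z ω)) (t.2.1, t.2.2) / push p Z t.2.2 := by
        refine Finset.sum_le_sum fun t _ => ?_
        rcases (push_nonneg hn (fun ω => (X ω, Y ω, Z ω)) t).eq_or_lt with h | h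
        · rw [← h, zero_mul]
          exact div_nonneg (mul_nonneg (push_nonneg hn _ _) (push_nonneg hn _ _))
            (push_nonneg hn _ _)
        · rw [mul_div_assoc', mul_div_mul_left _ _ h.ne']
    _ = ∑ z, (∑ x, push p (fun ω => (X ω, Z ω)) (x, z)) *
          (∑ y, push p (fun ω => (Y ω, Z ω)) (y, z)) / push p Z z := by
        simp only [Fintype.sum_prod_type, Finset.sum_mul_sum, Finset.sum_div]
        rw [Finset.sum_comm (s := (Finset.univ : Finset γ))]
        exact Finset.sum_congr rfl fun x _ => Finset.sum_comm
    _ = ∑ z, push p Z z := by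
        simp only [sum_push_pair, mul_self_div_self]
    _ ≤ 1 := (sum_push p Z).trans hp.2 |>.le

theorem condMI_nonneg (hp : IsPMF p) (X : Ω → α) (Y : Ω → β) (Z : Ω → γ) :
    0 ≤ condMI p X Y Z := by
  have hn := hp.1
  have hlog : 0 < Real.log 2 := Real.log_pos one_lt_two
  rw [condMI, entRV_eq_sum, entRV_eq_sum, entRV_eq_sum, entRV_eq_sum]
  have key : ∀ ω, (p ω - p ω * (push p (fun ω => (X ω, Z ω)) (X ω, Z ω) *
      push p (fun ω => (Y ω, Z ω)) (Y ω, Z ω) /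
        (push p (fun ω => (X ω, Y ω, Z ω)) (X ω, Y ω, Z ω) * push p Z (Z ω)))) / Real.log 2 ≤
      p ω * Real.logb 2 (push p (fun ω => (X ω, Y ω, Z ω)) (X ω, Y ω, Z ω)) +
        p ω * Real.logb 2 (push p Z (Z ω)) -
        p ω * Real.logb 2 (push p (fun ω => (X ω, Z ω)) (X ω, Z ω)) -
        p ω * Real.logb 2 (push p (fun ω => (Y ω, Z ω)) (Y ω, Z ω)) := by
    intro ω
    rcases (hn ω).eq_or_lt with h | h
    · simp [← h]
    have h₁ := push_apply_pos hn (fun ω => (X ω, Y ω, Z ω)) h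
    have h₂ := push_apply_pos hn Z h
    have h₃ := push_apply_pos hn (fun ω => (X ω, Z ω)) h
    have h₄ := push_apply_pos hn (fun ω => (Y ω, Z ω)) h
    have hl := Real.log_le_sub_one_of_pos (div_pos (mul_pos h₃ h₄) (mul_pos h₁ h₂))
    rw [Real.log_div (mul_pos h₃ h₄).ne' (mul_pos h₁ h₂).ne', Real.log_mul h₃.ne' h₄.ne',
      Real.log_mul h₁.ne' h₂.ne'] at hl
    rw [div_le_iff₀ hlog]
    simp only [Real.logb, ← mul_add, ← mul_sub, ← add_div, ← sub_div]
    rw [mul_assoc, div_mul_cancel₀ _ hlog.ne', ← mul_one_sub]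
    exact mul_le_mul_of_nonneg_left (by linarith) h.le
  have hsum := Finset.sum_le_sum fun ω (_ : ω ∈ Finset.univ) => key ω
  simp only [Finset.sum_add_distrib, Finset.sum_sub_distrib, ← Finset.sum_div, hp.2] at hsum
  have := div_nonneg (sub_nonneg.2 (sum_mul_div_push_le hp X Y Z)) hlog.le
  linarith

/-- Data processing: if `K` is almost surely a function of `Y`, then `I(X;K|Z) ≤ I(X;Y|Z)`. -/
theorem condMI_le_of_factors {δ : Type*} [Fintype δ] (hp : IsPMF p) (X : Ω → α) {Y : Ω → β}
    {K : Ω → δ} (Z : Ω → γ)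
    (hK : ∀ ω ω', p ω ≠ 0 → p ω' ≠ 0 → Y ω = Y ω' → K ω = K ω') :
    condMI p X K Z ≤ condMI p X Y Z := by
  have h := condMI_nonneg hp X Y fun ω => (K ω, Z ω)
  have h₁ : entRV p (fun ω => (Y ω, K ω, Z ω)) = entRV p fun ω => (Y ω, Z ω) :=
    entRV_congr fun ω ω' hω hω' => by
      have := hK ω ω' hω hω'
      simp only [Prod.mk.injEq]
      tauto
  have h₂ : entRV p (fun ω => (X ω, Y ω, K ω, Z ω)) = entRV p fun ω => (X ω, Y ω, Z ω) :=
    entRV_congr fun ω ω' hω hω' => by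
      have := hK ω ω' hω hω'
      simp only [Prod.mk.injEq]
      tauto
  unfold condMI at h ⊢
  linarith

lemma condMI_push {δ : Type*} [Fintype δ] (p : Ω → ℝ) (T : Ω → δ) (X : δ → α) (Y : δ → β)
    (Z : δ → γ) :
    condMI (push p T) X Y Z =
      condMI p (fun ω => X (T ω)) (fun ω => Y (T ω)) fun ω => Z (T ω) := by
  simp only [condMI, entRV, push_push]

end Entropy

section GacsKorner

lemma GKConn.symm {p : α × β → ℝ} {y₁ y₂ : β} (h : GKConn p y₁ y₂) : GKConn p y₂ y₁ := by
  induction h with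
  | refl => exact .refl
  | tail _ hstep ih =>
    obtain ⟨x, hx⟩ := hstep
    exact .head ⟨x, hx.symm⟩ ih

lemma exists_isGKMap (p : α × β → ℝ) : ∃ g, IsGKMap p g := by
  let s : Setoid β := ⟨GKConn p, fun _ => .refl, GKConn.symm, .trans⟩
  exact ⟨fun y => (Quotient.mk s y).out, fun y₁ y₂ => Quotient.out_inj.trans Quotient.eq⟩

/-- If `A` is common to both sides, connected nodes agree in `A` and are connected in the graph
of the pair `(U,V)`. -/
lemma GKConn.of_common_left {U V : Type*} [Fintype Ω] {p : Ω → ℝ} (hp : ∀ ω, 0 ≤ p ω) {X : Ω → α} {Y : Ω → U}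
    {Z : Ω → V} {y₁ y₂ : α × V}
    (h : GKConn (push p fun ω => ((X ω, Y ω), (X ω, Z ω))) y₁ y₂) :
    y₁.1 = y₂.1 ∧ GKConn (push p fun ω => (Y ω, Z ω)) y₁.2 y₂.2 := by
  induction h with
  | refl => exact ⟨rfl, .refl⟩
  | tail _ hstep ih =>
    obtain ⟨⟨x, u⟩, h₁, h₂⟩ := hstep
    obtain ⟨ω₁, hω₁, e₁⟩ := (push_pos_iff hp).1 h₁
    obtain ⟨ω₂, hω₂, e₂⟩ := (push_pos_iff hp).1 h₂
    simp only [Prod.ext_iff] at e₁ e₂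
    obtain ⟨⟨e₁x, e₁u⟩, e₁x', e₁v⟩ := e₁
    obtain ⟨⟨e₂x, e₂u⟩, e₂x', e₂v⟩ := e₂
    refine ⟨ih.1.trans (by rw [← e₁x', ← e₂x', e₁x, e₂x]), ih.2.tail ⟨u, ?_, ?_⟩⟩
    · exact (push_pos_iff hp).2 ⟨ω₁, hω₁, by rw [e₁u, e₁v]⟩
    · exact (push_pos_iff hp).2 ⟨ω₂, hω₂, by rw [e₂u, e₂v]⟩

variable {S U V A B C : Type*} [Fintype S] [Fintype U] [Fintype V] [Fintype A] [Fintype B]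
  [Fintype C]

/-- If the joint support of `(A,B,C)` and `(U,V)` is a product set, a path for the pair
`((A,B),(A,C))` and a path for `(U,V)` combine into a path for `((A,B,U),(A,C,V))`. -/
lemma GKConn.combine {q : (A × B × C) × S × U × V → ℝ} (hq : ∀ x, 0 ≤ q x)
    (hprod : ∀ x y, 0 < q x → 0 < q y → ∃ s, 0 < q (x.1, s, y.2.2))
    {x y : (A × B × C) × S × U × V} (hx : 0 < q x) (hy : 0 < q y)
    (hAC : GKConn (push q fun x => ((x.1.1, x.1.2.1), (x.1.1, x.1.2.2)))
      (x.1.1, x.1.2.2) (y.1.1, y.1.2.2))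
    (hV : GKConn (push q fun x => (x.2.2.1, x.2.2.2)) x.2.2.2 y.2.2.2) :
    GKConn (push q fun x => ((x.1.1, x.1.2.1, x.2.2.1), (x.1.1, x.1.2.2, x.2.2.2)))
      (x.1.1, x.1.2.2, x.2.2.2) (y.1.1, y.1.2.2, y.2.2.2) := by
  have pos : ∀ x y, 0 < q x → 0 < q y →
      0 < push q (fun x => ((x.1.1, x.1.2.1, x.2.2.1), (x.1.1, x.1.2.2, x.2.2.2)))
        ((x.1.1, x.1.2.1, y.2.2.1), (x.1.1, x.1.2.2, y.2.2.2)) := fun x y hx hy => by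
    obtain ⟨s, hs⟩ := hprod x y hx hy
    exact (push_pos_iff hq).2 ⟨_, hs, rfl⟩
  have h₁ := hAC.lift (p := GKStep (push q fun x =>
      ((x.1.1, x.1.2.1, x.2.2.1), (x.1.1, x.1.2.2, x.2.2.2))))
    (fun t : A × C => (t.1, t.2, x.2.2.2)) (by
      rintro ⟨a₁, c₁⟩ ⟨a₂, c₂⟩ ⟨⟨a, b⟩, h, h'⟩
      obtain ⟨z, hz, e⟩ := (push_pos_iff hq).1 h
      obtain ⟨z', hz', e'⟩ := (push_pos_iff hq).1 h'
      simp only [Prod.mk.injEq] at e e'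
      have hs := pos z x hz hx
      have hs' := pos z' x hz' hx
      rw [e.1.2, e.2.1, e.2.2] at hs
      rw [e'.1.2, e'.2.1, e'.2.2] at hs'
      obtain rfl : a₁ = a := e.2.1.symm.trans e.1.1
      obtain rfl : a₂ = a₁ := e'.2.1.symm.trans e'.1.1
      exact ⟨_, hs, hs'⟩)
  have h₂ := hV.lift (p := GKStep (push q fun x =>
      ((x.1.1, x.1.2.1, x.2.2.1), (x.1.1, x.1.2.2, x.2.2.2))))
    (fun v : V => (y.1.1, y.1.2.2, v)) (by
      rintro v₁ v₂ ⟨u, h, h'⟩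
      obtain ⟨z, hz, e⟩ := (push_pos_iff hq).1 h
      obtain ⟨z', hz', e'⟩ := (push_pos_iff hq).1 h'
      simp only [Prod.mk.injEq] at e e'
      have hs := pos y z hy hz
      have hs' := pos y z' hy hz'
      rw [e.1, e.2] at hs
      rw [e'.1, e'.2] at hs'
      exact ⟨_, hs, hs'⟩)
  exact Relation.ReflTransGen.trans h₁ h₂

/-- Under the full-support condition, a Markov chain `A – S – (U,V)` makes the joint support of
`A` and `(U,V)` a product set. -/
lemma MarkovChain.exists_pos_of_fullSupport {p : S × U × V → ℝ} (hp : ∀ y, 0 ≤ p y)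
    (hsupp : ∀ s u v, 0 < p (s, u, v) ↔
      (0 < push p (fun x => x.1) s ∧ 0 < push p (fun x => x.2) (u, v)))
    {q : A × S × U × V → ℝ} (hq : ∀ x, 0 ≤ q x)
    (hmarg : push q (fun x => x.2) = p)
    (hM : MarkovChain q (fun x => x.1) (fun x => x.2.1) fun x => x.2.2)
    (x y : A × S × U × V) (hx : 0 < q x) (hy : 0 < q y) : ∃ s, 0 < q (x.1, s, y.2.2) := by
  have hpx : 0 < p x.2 := by rw [← hmarg]; exact push_apply_pos hq (fun x => x.2) hx
  have hpy : 0 < p y.2 := by rw [← hmarg]; exact push_apply_pos hq (fun x => x.2) hy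
  have hmix : 0 < p (x.2.1, y.2.2) :=
    (hsupp _ _ _).2 ⟨push_apply_pos hp (fun x => x.1) hpx, push_apply_pos hp (fun x => x.2) hpy⟩
  rw [← hmarg, push_pos_iff hq] at hmix
  obtain ⟨z, hz, e⟩ := hmix
  have hzs := push_apply_pos hq (fun x => (x.2.2, x.2.1)) hz
  simp only [e] at hzs
  have h := hM x.1 x.2.1 y.2.2
  have hpos := mul_pos (push_apply_pos hq (fun x => (x.1, x.2.1)) hx) hzs
  rw [← h] at hpos
  obtain ⟨w, hw, e'⟩ := (push_pos_iff hq).1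
    (pos_of_mul_pos_left hpos (push_nonneg hq _ _))
  exact ⟨x.2.1, by rwa [← e']⟩

end GacsKorner

/-- Lemma 5: if supp(S,U,V) = supp(S) × supp(U,V), then
ℛ‡_k(D) ⊆ ℛ*_{k²}(D) for every k and D ≥ 0. -/
theorem stmt5 {S U V W : Type*} [Fintype S] [Fintype U] [Fintype V] [Fintype W]
    (p : S × U × V → ℝ) (hp : IsPMF p) (Dbar : ℝ) (hDbar : 0 < Dbar)
    (d : S → W → ℝ) (hd : ∀ s w, 0 ≤ d s w ∧ d s w ≤ Dbar)
    (hsupp : ∀ s u v, 0 < p (s, u, v) ↔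
      (0 < push p (fun x => x.1) s ∧ 0 < push p (fun x => x.2) (u, v)))
    (k : ℕ) (D : ℝ) (hD : 0 ≤ D) :
    RDdag p d D k ⊆ RStar p d D (k ^ 2) := by
  rintro ⟨r₁, r₂⟩ ⟨hr₁, hr₂, q, ⟨hq, hmarg, hM, g, f, hg, hdist⟩, hU, hV⟩
  have hn := hq.1
  have hmarg' : push q (fun x => x.2) = p := funext hmarg
  obtain ⟨h, hh⟩ := exists_isGKMap
    (push q fun x => ((x.1.1, x.1.2.1), (x.1.1, x.1.2.2)))
  let e : Fin k × Fin k ≃ Fin (k ^ 2) := finProdFinEquiv.trans (finCongr (sq k).symm)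
  let K : Fin k × Fin k × Fin k → Fin (k ^ 2) := fun t => e (h (t.1, t.2.2))
  let T : (Fin k × Fin k × Fin k) × S × U × V → Fin (k ^ 2) × S × U × V :=
    fun x => (K x.1, x.2)
  obtain ⟨g', hg'⟩ := exists_isGKMap
    (push (push q T) fun x => ((x.1, x.2.2.1), (x.1, x.2.2.2)))
  have factor : ∀ x y, 0 < q x → 0 < q y →
      g' (K x.1, x.2.2.2) = g' (K y.1, y.2.2.2) →
      g (x.1.1, x.1.2.2, x.2.2.2) = g (y.1.1, y.1.2.2, y.2.2.2) := by
    intro x y hx hy hxy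
    rw [hg', push_push] at hxy
    obtain ⟨hK, hconn⟩ := GKConn.of_common_left hn (X := fun x => K x.1)
      (Y := fun x => x.2.2.1) (Z := fun x => x.2.2.2) hxy
    exact (hg _ _).2 (GKConn.combine hn
      (hM.exists_pos_of_fullSupport hp.1 hsupp hn hmarg') hx hy
      ((hh _ _).1 (e.injective hK)) hconn)
  let R : Fin (k ^ 2) × V → Fin k × Fin k × V := fun y =>
    if hy : ∃ x, 0 < q x ∧ g' (K x.1, x.2.2.2) = y then
      (hy.choose.1.1, hy.choose.1.2.2, hy.choose.2.2.2)
    else ((e.symm y.1).1, (e.symm y.1).2, y.2)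
  have hR : ∀ x, 0 < q x →
      g (R (g' (K x.1, x.2.2.2))) = g (x.1.1, x.1.2.2, x.2.2.2) := by
    intro x hx
    have hy : ∃ z, 0 < q z ∧ g' (K z.1, z.2.2.2) = g' (K x.1, x.2.2.2) := ⟨x, hx, rfl⟩
    simp only [R, dif_pos hy]
    exact factor _ _ hy.choose_spec.1 hx hy.choose_spec.2
  refine ⟨hr₁, hr₂, push q T, ⟨⟨push_nonneg hn T, (sum_push q T).trans hq.2⟩, ?_, ?_,
    g', fun y => f (g (R y)), hg', ?_⟩, ?_, ?_⟩
  · intro y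
    rw [push_push]
    exact hmarg y
  · exact MarkovChain.push_iff.2 (hM.comp_left K)
  · rw [expVal, sum_push_mul]
    refine le_of_eq_of_le (Finset.sum_congr rfl fun x _ => ?_) hdist
    rcases (hn x).eq_or_lt with hx | hx
    · simp [← hx]
    · simp only [T, hR x hx]
  · rw [condMI_push]
    refine (condMI_le_of_factors hq _ _ fun x y hx hy hxy => ?_).trans hU
    have hx := (hn x).lt_of_ne' hx
    have hy := (hn y).lt_of_ne' hy
    simp only [Prod.mk.injEq] at hxy
    refine congrArg e ((hh _ _).2 (.single ⟨(x.1.1, x.1.2.1), ?_, ?_⟩))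
    · exact (push_pos_iff hn).2 ⟨x, hx, rfl⟩
    · exact (push_pos_iff hn).2 ⟨y, hy, by rw [hxy.1, hxy.2]⟩
  · have hB := condMI_nonneg hq (fun x => x.2.1) (fun x => x.1.2.1)
      fun x => (x.1.1, x.1.2.2, x.2.2)
    rw [condMI_push]
    refine (condMI_le_of_factors hq _ _ fun x y _ _ hxy => ?_).trans
      ((le_add_of_nonneg_left hB).trans hV)
    exact congrArg (fun t => e (h t)) hxy

end CRR
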